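/- arXiv:2406.15904 — 2 statements merged into one kernel-verified Lean document; each statement's English description precedes it below -/
import Mathlib

section
/- Let Σ, D ∈ ℝ^{d×d} be symmetric matrices with Σ positive semidefinite, let b ∈ ℝ^d, υ > 0, η ≥ 0, let V ∈ St(d, ℓ), and set α_V := (Vᵀ Σ V + υ I_ℓ)⁻¹ Vᵀ b and ξ_V := (Σ V α_V − b) α_Vᵀ + η D V Vᵀ D V. Then Vᵀ ξ_V = −υ α_V α_Vᵀ + η Vᵀ D V Vᵀ D V, and in particular Vᵀ ξ_V is a symmetric matrix (so the skew part of Vᵀ ξ_V vanishes and the tangent-space projection of ξ_V at V on the Stiefel manifold equals (I_d − V Vᵀ) ξ_V). -/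
open Matrix

noncomputable section

/-- Largest value of the Rayleigh quotient `x ⬝ᵥ A *ᵥ x` over Euclidean-unit vectors;
for a symmetric matrix this is the largest eigenvalue `λ_max(A)`. -/
noncomputable def lmax {n : ℕ} (A : Matrix (Fin n) (Fin n) ℝ) : ℝ :=
  sSup {c : ℝ | ∃ x : Fin n → ℝ, x ⬝ᵥ x = 1 ∧ c = x ⬝ᵥ (A *ᵥ x)}

/-- Smallest value of the Rayleigh quotient `x ⬝ᵥ A *ᵥ x` over Euclidean-unit vectors;
for a symmetric matrix this is the smallest eigenvalue `λ_min(A)`. -/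
noncomputable def lmin {n : ℕ} (A : Matrix (Fin n) (Fin n) ℝ) : ℝ :=
  sInf {c : ℝ | ∃ x : Fin n → ℝ, x ⬝ᵥ x = 1 ∧ c = x ⬝ᵥ (A *ᵥ x)}

/-- The spectral (ℓ₂-operator) norm of a matrix: `‖A‖_op = √(λ_max (Aᵀ A))`. -/
noncomputable def opNorm {m n : ℕ} (A : Matrix (Fin m) (Fin n) ℝ) : ℝ :=
  Real.sqrt (lmax (Aᵀ * A))

/-- The squared Frobenius norm `‖A‖_F² = ∑ᵢⱼ Aᵢⱼ²`. -/
noncomputable def frobSq {m n : ℕ} (A : Matrix (Fin m) (Fin n) ℝ) : ℝ :=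
  ∑ i, ∑ j, A i j ^ 2


theorem posDef_compression_add_smul_one {m n : Type*} [Fintype m] [Fintype n] [DecidableEq n]
    {A : Matrix m m ℝ} (hA : A.PosSemidef) (V : Matrix m n ℝ) {υ : ℝ} (hυ : 0 < υ) :
    (Vᵀ * A * V + υ • (1 : Matrix n n ℝ)).PosDef := by
  have h := hA.conjTranspose_mul_mul_same V
  rw [conjTranspose_eq_transpose_of_trivial] at h
  exact PosDef.posSemidef_add h (PosDef.one.smul hυ)

/-- For `V` on the Stiefel manifold, the Euclidean gradient
`ξ_V = (Σ V α_V − b) α_Vᵀ + η D V Vᵀ D V` satisfies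
`Vᵀ ξ_V = −υ α_V α_Vᵀ + η Vᵀ D V Vᵀ D V`, which is symmetric; hence its skew part
vanishes and the tangent projection of `ξ_V` equals `(I − V Vᵀ) ξ_V`. -/
theorem stiefel_gradient_projection {d ℓ : ℕ} (Sig D : Matrix (Fin d) (Fin d) ℝ)
    (hSig : Sig.PosSemidef) (hD : D.IsSymm) (b : Fin d → ℝ) (υ η : ℝ)
    (hυ : 0 < υ) (hη : 0 ≤ η) (V : Matrix (Fin d) (Fin ℓ) ℝ) (hV : Vᵀ * V = 1)
    (αV : Fin ℓ → ℝ)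
    (hα : αV = (Vᵀ * Sig * V + υ • (1 : Matrix (Fin ℓ) (Fin ℓ) ℝ))⁻¹ *ᵥ (Vᵀ *ᵥ b))
    (ξV : Matrix (Fin d) (Fin ℓ) ℝ)
    (hξ : ξV = Matrix.vecMulVec (Sig *ᵥ (V *ᵥ αV) - b) αV + η • (D * V * Vᵀ * D * V)) :
    Vᵀ * ξV = -(υ • Matrix.vecMulVec αV αV) + η • (Vᵀ * D * V * Vᵀ * D * V) ∧
      (Vᵀ * ξV)ᵀ = Vᵀ * ξV ∧
      (1 / 2 : ℝ) • (Vᵀ * ξV - (Vᵀ * ξV)ᵀ) = 0 ∧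
      ((1 : Matrix (Fin d) (Fin d) ℝ) - V * Vᵀ) * ξV +
          V * ((1 / 2 : ℝ) • (Vᵀ * ξV - (Vᵀ * ξV)ᵀ)) =
        ((1 : Matrix (Fin d) (Fin d) ℝ) - V * Vᵀ) * ξV := by
  have hM := posDef_compression_add_smul_one hSig V hυ
  have hnormal : (Vᵀ * Sig * V + υ • (1 : Matrix (Fin ℓ) (Fin ℓ) ℝ)) *ᵥ αV = Vᵀ *ᵥ b := by
    rw [hα, mulVec_mulVec, mul_nonsing_inv _ ((isUnit_iff_isUnit_det _).mp hM.isUnit),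
      one_mulVec]
  have hresidual : Vᵀ *ᵥ (Sig *ᵥ (V *ᵥ αV) - b) = -(υ • αV) := by
    rw [mulVec_sub, ← hnormal, add_mulVec, smul_mulVec, one_mulVec, mulVec_mulVec, mulVec_mulVec]
    abel
  have hformula : Vᵀ * ξV =
      -(υ • Matrix.vecMulVec αV αV) + η • (Vᵀ * D * V * Vᵀ * D * V) := by
    rw [hξ, Matrix.mul_add, mul_vecMulVec, hresidual, neg_vecMulVec, smul_vecMulVec,
      Matrix.mul_smul]
    simp only [Matrix.mul_assoc]
  have hsymm : (Vᵀ * ξV)ᵀ = Vᵀ * ξV := by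
    rw [hformula]
    simp [transpose_mul, transpose_vecMulVec, hD.eq, Matrix.mul_assoc]
  refine ⟨hformula, hsymm, ?_, ?_⟩ <;> simp [hsymm]
end
end

section
/- Let V ∈ St(d, ℓ), let Δ ∈ ℝ^{d×r} with Δᵀ Δ = I_r, let M ∈ ℝ^{r×r} be symmetric positive semidefinite, set D := Δ M Δᵀ and A := Vᵀ Δ. Then Tr[Vᵀ D V Vᵀ D (I_d − V Vᵀ) D V Vᵀ D V] = Tr[A M Aᵀ A M (I_r − Aᵀ A) M Aᵀ A M Aᵀ] ≥ λ_min(I_r − Aᵀ A) · λ_min(M)⁴ · ‖A Aᵀ‖_op³. -/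
open Matrix

noncomputable section

theorem dotProduct_sq_le {n : ℕ} (x y : Fin n → ℝ) :
    (x ⬝ᵥ y) ^ 2 ≤ (x ⬝ᵥ x) * (y ⬝ᵥ y) := by
  have h := Finset.sum_mul_sq_le_sq_mul_sq Finset.univ x y
  simpa only [dotProduct, ← pow_two] using h

theorem zero_le_dotProduct_self {n : ℕ} (x : Fin n → ℝ) : 0 ≤ x ⬝ᵥ x :=
  Finset.sum_nonneg fun i _ => mul_self_nonneg (x i)

theorem Matrix.PosSemidef.dotProduct_mulVec_self_nonneg {n : ℕ} {B : Matrix (Fin n) (Fin n) ℝ}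
    (hB : B.PosSemidef) (x : Fin n → ℝ) : 0 ≤ x ⬝ᵥ (B *ᵥ x) := by
  simpa using hB.dotProduct_mulVec_nonneg x

theorem lmin_nonneg {n : ℕ} {B : Matrix (Fin n) (Fin n) ℝ} (hB : B.PosSemidef) :
    0 ≤ lmin B := by
  refine Real.sInf_nonneg ?_
  rintro _ ⟨x, -, rfl⟩
  exact hB.dotProduct_mulVec_self_nonneg x

theorem lmin_mul_dotProduct_self_le {n : ℕ} {B : Matrix (Fin n) (Fin n) ℝ} (hB : B.PosSemidef)
    (x : Fin n → ℝ) : lmin B * (x ⬝ᵥ x) ≤ x ⬝ᵥ (B *ᵥ x) := by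
  rcases (zero_le_dotProduct_self x).eq_or_lt with h | h
  · rw [← h, mul_zero]
    exact hB.dotProduct_mulVec_self_nonneg x
  · have hs : Real.sqrt (x ⬝ᵥ x) ^ 2 = x ⬝ᵥ x := Real.sq_sqrt h.le
    have hs0 : Real.sqrt (x ⬝ᵥ x) ≠ 0 := (Real.sqrt_pos.mpr h).ne'
    rw [← le_div_iff₀ h]
    refine csInf_le ⟨0, ?_⟩ ⟨(Real.sqrt (x ⬝ᵥ x))⁻¹ • x, ?_, ?_⟩
    · rintro _ ⟨y, -, rfl⟩
      exact hB.dotProduct_mulVec_self_nonneg y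
    · simp only [smul_dotProduct, dotProduct_smul, smul_eq_mul]
      nth_rewrite 3 [← hs]
      field_simp
    · simp only [mulVec_smul, smul_dotProduct, dotProduct_smul, smul_eq_mul]
      nth_rewrite 1 [← hs]
      field_simp

theorem lmin_sq_mul_dotProduct_self_le {n : ℕ} {B : Matrix (Fin n) (Fin n) ℝ}
    (hB : B.PosSemidef) (x : Fin n → ℝ) :
    lmin B ^ 2 * (x ⬝ᵥ x) ≤ (B *ᵥ x) ⬝ᵥ (B *ᵥ x) := by
  have h1 := lmin_mul_dotProduct_self_le hB x
  have h2 := dotProduct_sq_le x (B *ᵥ x)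
  have h3 := lmin_nonneg hB
  rcases (zero_le_dotProduct_self x).eq_or_lt with h | h
  · rw [← h, mul_zero]
    exact zero_le_dotProduct_self _
  · have h4 := pow_le_pow_left₀ (mul_nonneg h3 h.le) h1 2
    refine le_of_mul_le_mul_left ?_ h
    linarith [mul_pow (lmin B) (x ⬝ᵥ x) 2]

theorem trace_mul_mul_transpose {m n : ℕ} (Y : Matrix (Fin m) (Fin n) ℝ)
    (B : Matrix (Fin n) (Fin n) ℝ) :
    trace (Y * B * Yᵀ) = ∑ i, Y i ⬝ᵥ (B *ᵥ Y i) := by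
  refine Finset.sum_congr rfl fun i _ => ?_
  rw [Matrix.mul_assoc, diag_apply, mul_apply]
  rfl

theorem trace_mul_transpose_self {m n : ℕ} (Y : Matrix (Fin m) (Fin n) ℝ) :
    trace (Y * Yᵀ) = ∑ i, Y i ⬝ᵥ Y i := rfl

theorem mul_trace_le_trace {m n : ℕ} (Y : Matrix (Fin m) (Fin n) ℝ)
    {B : Matrix (Fin n) (Fin n) ℝ} {c : ℝ} (h : ∀ x, c * (x ⬝ᵥ x) ≤ x ⬝ᵥ (B *ᵥ x)) :
    c * trace (Y * Yᵀ) ≤ trace (Y * B * Yᵀ) := by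
  rw [trace_mul_mul_transpose, trace_mul_transpose_self, Finset.mul_sum]
  exact Finset.sum_le_sum fun i _ => h (Y i)

theorem trace_mul_transpose_self_nonneg {m n : ℕ} (Y : Matrix (Fin m) (Fin n) ℝ) :
    0 ≤ trace (Y * Yᵀ) :=
  Finset.sum_nonneg fun i _ => zero_le_dotProduct_self (Y i)

theorem dotProduct_mulVec_self_le_trace {m n : ℕ} (Y : Matrix (Fin m) (Fin n) ℝ)
    (x : Fin n → ℝ) : (Y *ᵥ x) ⬝ᵥ (Y *ᵥ x) ≤ trace (Y * Yᵀ) * (x ⬝ᵥ x) := by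
  rw [trace_mul_transpose_self, Finset.sum_mul]
  refine Finset.sum_le_sum fun i _ => ?_
  rw [← pow_two]
  exact dotProduct_sq_le (Y i) x

theorem mulVec_dotProduct_eq {m n : ℕ} (A : Matrix (Fin m) (Fin n) ℝ) (x : Fin n → ℝ)
    (y : Fin m → ℝ) : (A *ᵥ x) ⬝ᵥ y = x ⬝ᵥ (Aᵀ *ᵥ y) := by
  rw [dotProduct_comm, dotProduct_mulVec, dotProduct_comm, mulVec_transpose]

/-- The Frobenius norm of `A M Aᵀ A` dominates the moments of `A Aᵀ` along any unit vector. -/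
theorem lmin_pow_mul_pow_le_trace_sq {m n : ℕ} (A : Matrix (Fin m) (Fin n) ℝ)
    {M : Matrix (Fin n) (Fin n) ℝ} (hM : M.PosSemidef) {u : Fin m → ℝ} (hu : u ⬝ᵥ u = 1) :
    lmin M ^ 4 * (((A * Aᵀ) *ᵥ u) ⬝ᵥ ((A * Aᵀ) *ᵥ u)) ^ 3 ≤
      trace (A * M * Aᵀ * A * (A * M * Aᵀ * A)ᵀ) ^ 2 := by
  set T := trace (A * M * Aᵀ * A * (A * M * Aᵀ * A)ᵀ)
  set p := Aᵀ *ᵥ u with hp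
  set w := (A * Aᵀ) *ᵥ u with hw
  set q := Aᵀ *ᵥ w with hq
  set y := (A * M * Aᵀ * A) *ᵥ p with hy
  have hwp : w = A *ᵥ p := by rw [hw, hp, mulVec_mulVec]
  have hyq : y = A *ᵥ (M *ᵥ q) := by
    simp only [hy, hq, hwp, mulVec_mulVec, Matrix.mul_assoc]
  have hT : 0 ≤ T := trace_mul_transpose_self_nonneg _
  have hyT : y ⬝ᵥ y ≤ T * (p ⬝ᵥ p) := dotProduct_mulVec_self_le_trace _ _
  have hwy : w ⬝ᵥ y = q ⬝ᵥ (M *ᵥ q) := by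
    rw [hyq, dotProduct_comm, mulVec_dotProduct_eq, dotProduct_comm]
  have hwy2 := dotProduct_sq_le w y
  have hMq := lmin_mul_dotProduct_self_le hM q
  have hm := lmin_nonneg hM
  have h12 : (p ⬝ᵥ p) ^ 2 ≤ w ⬝ᵥ w := by
    have h := dotProduct_sq_le u w
    have e : p ⬝ᵥ p = u ⬝ᵥ w := by
      rw [hwp, hp, mulVec_dotProduct_eq, transpose_transpose]
    rwa [hu, one_mul, ← e] at h
  have h123 : (w ⬝ᵥ w) ^ 2 ≤ (p ⬝ᵥ p) * (q ⬝ᵥ q) := by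
    have h := dotProduct_sq_le p q
    have e : w ⬝ᵥ w = p ⬝ᵥ q := by
      nth_rewrite 1 [hwp]
      rw [mulVec_dotProduct_eq]
    rwa [← e] at h
  have hq0 := zero_le_dotProduct_self q
  have hp0 := zero_le_dotProduct_self p
  have hw0 := zero_le_dotProduct_self w
  generalize q ⬝ᵥ (M *ᵥ q) = e at *
  generalize w ⬝ᵥ y = e' at *
  generalize y ⬝ᵥ y = f at *
  generalize p ⬝ᵥ p = a at *
  generalize w ⬝ᵥ w = b at *
  generalize q ⬝ᵥ q = c at *
  generalize lmin M = k at *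
  subst hwy
  rcases hw0.eq_or_lt with h0 | hb
  · rw [← h0]
    simpa using sq_nonneg T
  have ha : 0 < a := by
    rcases hp0.eq_or_lt with h0 | h0
    · rw [← h0] at h123
      nlinarith
    · exact h0
  have h1 : k ^ 2 * c ^ 2 ≤ b * (T * a) := by
    calc k ^ 2 * c ^ 2 = (k * c) ^ 2 := by ring
      _ ≤ e' ^ 2 := pow_le_pow_left₀ (by positivity) hMq 2
      _ ≤ b * f := hwy2
      _ ≤ b * (T * a) := by gcongr
  have h2 : k ^ 2 * b ^ 3 ≤ T * a ^ 3 := by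
    refine le_of_mul_le_mul_left ?_ hb
    calc b * (k ^ 2 * b ^ 3) = k ^ 2 * (b ^ 2) ^ 2 := by ring
      _ ≤ k ^ 2 * (a * c) ^ 2 := by gcongr
      _ = k ^ 2 * c ^ 2 * a ^ 2 := by ring
      _ ≤ b * (T * a) * a ^ 2 := by gcongr
      _ = b * (T * a ^ 3) := by ring
  have hb3 : 0 < b ^ 3 := by positivity
  refine le_of_mul_le_mul_left ?_ hb3
  calc b ^ 3 * (k ^ 4 * b ^ 3) = (k ^ 2 * b ^ 3) ^ 2 := by ring
    _ ≤ (T * a ^ 3) ^ 2 := by gcongr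
    _ = (a ^ 2) ^ 3 * T ^ 2 := by ring
    _ ≤ b ^ 3 * T ^ 2 := by gcongr

theorem lmin_sq_mul_opNorm_pow_le_trace {m n : ℕ} (A : Matrix (Fin m) (Fin n) ℝ)
    {M : Matrix (Fin n) (Fin n) ℝ} (hM : M.PosSemidef) :
    lmin M ^ 2 * opNorm (A * Aᵀ) ^ 3 ≤ trace (A * M * Aᵀ * A * (A * M * Aᵀ * A)ᵀ) := by
  have key := fun (u : Fin m → ℝ) (hu : u ⬝ᵥ u = 1) => lmin_pow_mul_pow_le_trace_sq A hM hu
  have hT := trace_mul_transpose_self_nonneg (A * M * Aᵀ * A)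
  have hm := lmin_nonneg hM
  generalize trace (A * M * Aᵀ * A * (A * M * Aᵀ * A)ᵀ) = T at *
  generalize lmin M = k at *
  rcases hm.eq_or_lt with h0 | hk
  · rw [← h0]
    simpa using hT
  have quad : ∀ u : Fin m → ℝ, u ⬝ᵥ (((A * Aᵀ)ᵀ * (A * Aᵀ)) *ᵥ u) =
      ((A * Aᵀ) *ᵥ u) ⬝ᵥ ((A * Aᵀ) *ᵥ u) := fun u => by
    rw [mulVec_dotProduct_eq, mulVec_mulVec]
  have hL0 : 0 ≤ lmax ((A * Aᵀ)ᵀ * (A * Aᵀ)) := by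
    refine Real.sSup_nonneg ?_
    rintro _ ⟨u, -, rfl⟩
    rw [quad]
    exact zero_le_dotProduct_self _
  set K := T ^ 2 / k ^ 4
  have hK : 0 ≤ K := by positivity
  have hK3 : (K ^ (1 / 3 : ℝ)) ^ 3 = K := by
    rw [← Real.rpow_natCast, ← Real.rpow_mul hK]
    norm_num
  have hL : lmax ((A * Aᵀ)ᵀ * (A * Aᵀ)) ≤ K ^ (1 / 3 : ℝ) := by
    refine Real.sSup_le ?_ (by positivity)
    rintro _ ⟨u, hu, rfl⟩
    rw [quad]
    refine le_of_pow_le_pow_left₀ three_ne_zero (by positivity) ?_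
    rw [hK3, le_div_iff₀' (by positivity)]
    exact key u hu
  have hL3 : k ^ 4 * lmax ((A * Aᵀ)ᵀ * (A * Aᵀ)) ^ 3 ≤ T ^ 2 := by
    rw [← le_div_iff₀' (by positivity)]
    exact (pow_le_pow_left₀ hL0 hL 3).trans hK3.le
  refine le_of_pow_le_pow_left₀ two_ne_zero hT ?_
  calc (k ^ 2 * opNorm (A * Aᵀ) ^ 3) ^ 2 = k ^ 4 * (opNorm (A * Aᵀ) ^ 2) ^ 3 := by ring
    _ = k ^ 4 * lmax ((A * Aᵀ)ᵀ * (A * Aᵀ)) ^ 3 := by rw [opNorm, Real.sq_sqrt hL0]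
    _ ≤ T ^ 2 := hL3

/-- The trace identity and lower bound used in the alignment analysis:
`Tr[VᵀDV VᵀD(I−VVᵀ)DV VᵀDV] = Tr[AMAᵀ AM(I−AᵀA)MAᵀ AMAᵀ]
  ≥ λ_min(I−AᵀA) λ_min(M)⁴ ‖AAᵀ‖_op³` where `A = Vᵀ Δ` and `D = Δ M Δᵀ`. -/
theorem trace_lower_bound {d r ℓ : ℕ} (V : Matrix (Fin d) (Fin ℓ) ℝ) (hV : Vᵀ * V = 1)
    (Δ : Matrix (Fin d) (Fin r) ℝ) (hΔ : Δᵀ * Δ = 1)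
    (M : Matrix (Fin r) (Fin r) ℝ) (hM : M.PosSemidef)
    (D : Matrix (Fin d) (Fin d) ℝ) (hD : D = Δ * M * Δᵀ)
    (A : Matrix (Fin ℓ) (Fin r) ℝ) (hA : A = Vᵀ * Δ) :
    Matrix.trace (Vᵀ * D * V * Vᵀ * D * ((1 : Matrix (Fin d) (Fin d) ℝ) - V * Vᵀ) *
          D * V * Vᵀ * D * V) =
        Matrix.trace (A * M * Aᵀ * A * M * ((1 : Matrix (Fin r) (Fin r) ℝ) - Aᵀ * A) *
          M * Aᵀ * A * M * Aᵀ) ∧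
      lmin ((1 : Matrix (Fin r) (Fin r) ℝ) - Aᵀ * A) * lmin M ^ 4 * opNorm (A * Aᵀ) ^ 3 ≤
        Matrix.trace (A * M * Aᵀ * A * M * ((1 : Matrix (Fin r) (Fin r) ℝ) - Aᵀ * A) *
          M * Aᵀ * A * M * Aᵀ) := by
  have hMt : Mᵀ = M := by simpa using hM.isHermitian.eq
  have hG : 1 - Aᵀ * A = Δᵀ * (1 - V * Vᵀ) * Δ := by
    simp only [hA, transpose_mul, transpose_transpose, Matrix.mul_sub, Matrix.sub_mul,
      Matrix.mul_one, hΔ, Matrix.mul_assoc]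
  constructor
  · rw [hG, hA, hD]
    simp only [transpose_mul, transpose_transpose, Matrix.mul_assoc]
  have hproj : 1 - V * Vᵀ = (1 - V * Vᵀ)ᵀ * (1 - V * Vᵀ) := by
    have h : V * Vᵀ * (V * Vᵀ) = V * Vᵀ := by
      rw [Matrix.mul_assoc, ← Matrix.mul_assoc Vᵀ, hV, Matrix.one_mul]
    simp [Matrix.mul_sub, Matrix.sub_mul, h]
  have hGpsd : (1 - Aᵀ * A).PosSemidef := by
    have h := posSemidef_conjTranspose_mul_self ((1 - V * Vᵀ) * Δ)
    rw [conjTranspose_eq_transpose_of_trivial, transpose_mul, Matrix.mul_assoc,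
      ← Matrix.mul_assoc _ _ Δ, ← hproj, ← Matrix.mul_assoc, ← hG] at h
    exact h
  set Y := A * M * Aᵀ * A
  have hYM : lmin M ^ 2 * trace (Y * Yᵀ) ≤ trace (Y * M * (Y * M)ᵀ) := by
    have h := mul_trace_le_trace Y (B := M * M) (c := lmin M ^ 2) fun x => by
      have e : x ⬝ᵥ ((M * M) *ᵥ x) = (M *ᵥ x) ⬝ᵥ (M *ᵥ x) := by
        rw [mulVec_dotProduct_eq, hMt, mulVec_mulVec]
      exact (lmin_sq_mul_dotProduct_self_le hM x).trans_eq e.symm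
    rwa [transpose_mul Y M, hMt, ← Matrix.mul_assoc, Matrix.mul_assoc Y M M]
  have hYG := mul_trace_le_trace (Y * M) (lmin_mul_dotProduct_self_le hGpsd)
  have hY := lmin_sq_mul_opNorm_pow_le_trace A hM
  calc lmin (1 - Aᵀ * A) * lmin M ^ 4 * opNorm (A * Aᵀ) ^ 3
      = lmin (1 - Aᵀ * A) * (lmin M ^ 2 * (lmin M ^ 2 * opNorm (A * Aᵀ) ^ 3)) := by ring
    _ ≤ lmin (1 - Aᵀ * A) * trace (Y * M * (Y * M)ᵀ) := by
        refine mul_le_mul_of_nonneg_left (le_trans ?_ hYM) (lmin_nonneg hGpsd)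
        exact mul_le_mul_of_nonneg_left hY (sq_nonneg _)
    _ ≤ _ := hYG
    _ = _ := by
        simp only [Y, transpose_mul, transpose_transpose, hMt, Matrix.mul_assoc]
end
end
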